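/- Let n ≥ 1, let A be an n×n matrix over ℕ with entries in {0,1}, and let B be the layered matrix of A (indexed by pairs (i,l) with l in {0,...,n}, with B((i,l),(j,l+1)) = A(i,j) for l ≤ n−2, B((i,l),(i,n)) = 1 for l ≤ n−1, and all other entries 0). Then for every vertex i: Σ_{k=0}^{n} (B^k)((i,0),(i,n)) ≥ 2 if and only if there exists k with 1 ≤ k ≤ n−1 and (A^k)(i,i) ≥ 1, i.e. if and only if the directed graph with adjacency matrix A has a closed walk through i of length between 1 and n−1. -/

import Mathlib

/-- The adjacency matrix of the layered graph `lay(G)` of a directed graph `G` on `n`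
vertices with adjacency matrix `A`: vertices are pairs `(i, l)` with `l ∈ {0, …, n}`;
there is an edge `(i, l) → (j, l+1)` (weight `A i j`) whenever `l ≤ n − 2`
(i.e. `l + 2 ≤ n`), and an edge `(i, l) → (i, n)` whenever `l ≤ n − 1`
(i.e. `l + 1 ≤ n`); all other entries are `0`. -/
def layered (n : ℕ) (A : Matrix (Fin n) (Fin n) ℕ) :
    Matrix (Fin n × Fin (n + 1)) (Fin n × Fin (n + 1)) ℕ :=
  fun p q =>
    (if (q.2 : ℕ) = (p.2 : ℕ) + 1 ∧ (p.2 : ℕ) + 2 ≤ n then A p.1 q.1 else 0) +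
    (if q.1 = p.1 ∧ (q.2 : ℕ) = n ∧ (p.2 : ℕ) + 1 ≤ n then 1 else 0)

theorem layered_pow_apply_of_lt (n : ℕ) (A : Matrix (Fin n) (Fin n) ℕ) (i : Fin n) (k : ℕ)
    (j : Fin n) (l : Fin (n + 1)) (hl : (l : ℕ) < n) :
    (layered n A ^ k) (i, 0) (j, l) = if (l : ℕ) = k then (A ^ k) i j else 0 := by
  induction k generalizing j l with
  | zero =>
    simp only [pow_zero, Matrix.one_apply, Prod.mk.injEq, Fin.ext_iff, Fin.val_zero]
    split_ifs <;> grind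
  | succ k ih =>
    have key : ∀ (m : Fin n) (l' : Fin (n + 1)),
        (layered n A ^ k) (i, 0) (m, l') * layered n A (m, l') (j, l) =
          if (l' : ℕ) = k then (if (l : ℕ) = k + 1 then (A ^ k) i m * A m j else 0) else 0 := by
      intro m l'
      have hlay : layered n A (m, l') (j, l) = if (l : ℕ) = l' + 1 then A m j else 0 := by
        simp only [layered]
        rw [if_neg (by omega : ¬ (j = m ∧ (l : ℕ) = n ∧ (l' : ℕ) + 1 ≤ n)), add_zero]
        exact if_congr (by omega) rfl rfl
      rw [hlay]
      by_cases h : (l : ℕ) = l' + 1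
      · rw [ih m l' (by omega)]
        split_ifs <;> omega
      · split_ifs <;> omega
    rw [pow_succ, Matrix.mul_apply, Fintype.sum_prod_type, pow_succ, Matrix.mul_apply]
    simp only [key]
    by_cases h : (l : ℕ) = k + 1
    · simp only [if_pos h]
      refine Finset.sum_congr rfl fun m _ => ?_
      rw [Finset.sum_eq_single (⟨k, by omega⟩ : Fin (n + 1)) (fun b _ hb => ?_) (by simp)]
      · simp
      · have : (b : ℕ) ≠ k := fun h => hb (Fin.ext h)
        simp [this]
    · simp [h]

theorem layered_pow_succ_apply_last (n : ℕ) (A : Matrix (Fin n) (Fin n) ℕ) (i j : Fin n)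
    (k : ℕ) (hk : k < n) :
    (layered n A ^ (k + 1)) (i, 0) (j, Fin.last n) = (A ^ k) i j := by
  have key : ∀ (m : Fin n) (l : Fin (n + 1)),
      (layered n A ^ k) (i, 0) (m, l) * layered n A (m, l) (j, Fin.last n) =
        if m = j then (if (l : ℕ) = k then (A ^ k) i m else 0) else 0 := by
    intro m l
    have hlay : layered n A (m, l) (j, Fin.last n) = if m = j ∧ (l : ℕ) < n then 1 else 0 := by
      simp only [layered, Fin.val_last]
      rw [if_neg (by omega : ¬ (n = (l : ℕ) + 1 ∧ (l : ℕ) + 2 ≤ n)), zero_add]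
      exact if_congr (by grind) rfl rfl
    rw [hlay]
    by_cases h : (l : ℕ) < n
    · rw [layered_pow_apply_of_lt n A i k m l h]
      by_cases hm : m = j <;> simp [hm, h]
    · rw [if_neg (by tauto), if_neg (by omega : ¬ (l : ℕ) = k)]
      simp
  rw [pow_succ, Matrix.mul_apply, Fintype.sum_prod_type]
  simp only [key]
  rw [Finset.sum_eq_single j (by intros; simp_all) (by simp),
    Finset.sum_eq_single (⟨k, by omega⟩ : Fin (n + 1)) (fun l _ hl => ?_) (by simp)]
  · simp
  · have : (l : ℕ) ≠ k := fun h => hl (Fin.ext h)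
    simp [this]

theorem sum_layered_pow_apply_last (n : ℕ) (hn : 1 ≤ n) (A : Matrix (Fin n) (Fin n) ℕ)
    (i : Fin n) :
    ∑ k ∈ Finset.range (n + 1), (layered n A ^ k) (i, 0) (i, Fin.last n) =
      ∑ k ∈ Finset.range n, (A ^ k) i i := by
  have h0 : (layered n A ^ 0) (i, 0) (i, Fin.last n) = 0 := by
    rw [pow_zero, Matrix.one_apply_ne]
    simp only [ne_eq, Prod.mk.injEq, Fin.ext_iff, Fin.val_zero, Fin.val_last]
    omega
  rw [Finset.sum_range_succ', h0, add_zero]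
  exact Finset.sum_congr rfl fun k hk =>
    layered_pow_succ_apply_last n A i i k (Finset.mem_range.mp hk)

/-- Let `n ≥ 1`, `A` an `n × n` matrix over `ℕ` with entries in `{0,1}`,
and `B` the layered matrix of `A`. Then for every vertex `i`, the total number of walks in
the layered graph from `(i, 0)` to `(i, n)` is at least `2` if and only if there is some
`k` with `1 ≤ k ≤ n − 1` and `(A^k) i i ≥ 1`, i.e. iff the directed graph with adjacency
matrix `A` has a closed walk through `i` of length between `1` and `n − 1`. -/
theorem stmt_14 (n : ℕ) (hn : 1 ≤ n) (A : Matrix (Fin n) (Fin n) ℕ)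
    (hA : ∀ i j, A i j = 0 ∨ A i j = 1) (i : Fin n) :
    2 ≤ ∑ k ∈ Finset.range (n + 1), (layered n A ^ k) (i, 0) (i, Fin.last n)
      ↔ ∃ k : ℕ, 1 ≤ k ∧ k ≤ n - 1 ∧ 1 ≤ (A ^ k) i i := by
  rw [sum_layered_pow_apply_last n hn A i]
  obtain ⟨m, rfl⟩ : ∃ m, n = m + 1 := ⟨n - 1, by omega⟩
  rw [Finset.sum_range_succ', pow_zero, Matrix.one_apply_eq]
  have hpos : 2 ≤ ∑ k ∈ Finset.range m, (A ^ (k + 1)) i i + 1 ↔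
      0 < ∑ k ∈ Finset.range m, (A ^ (k + 1)) i i := by omega
  rw [hpos, Finset.sum_pos_iff]
  constructor
  · rintro ⟨k, hk, h⟩
    exact ⟨k + 1, by omega, by have := Finset.mem_range.mp hk; omega, h⟩
  · rintro ⟨k, hk, hkm, h⟩
    refine ⟨k - 1, Finset.mem_range.mpr (by omega), ?_⟩
    rwa [Nat.sub_add_cancel hk]
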